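/- arXiv:2507.15123 — 3 statements merged into one kernel-verified Lean document; each statement's English description precedes it below -/
import Mathlib

section
/- (Taylor's theorem) For all positive integers n and r and every coloring c : FIN^[n] → {0,…,r−1}, there exists an infinite block sequence X ∈ FIN^[∞] such that c is constant on [X]^[n]. -/
/-- `blockLt s t` means every element of `s` is below every element of `t`
(for nonempty finite sets this is `max s < min t`). -/
def blockLt (s t : Finset ℕ) : Prop := ∀ a ∈ s, ∀ b ∈ t, a < b

/-- An infinite block sequence: a sequence of nonempty finite sets of naturals,
each block entirely below the next. -/
def IsBlockSeq (X : ℕ → Finset ℕ) : Prop :=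
  ∀ i, (X i).Nonempty ∧ blockLt (X i) (X (i + 1))

/-- A finite block sequence of length `n`. -/
def IsFinBlockSeq {n : ℕ} (a : Fin n → Finset ℕ) : Prop :=
  (∀ i, (a i).Nonempty) ∧ ∀ i j : Fin n, i < j → blockLt (a i) (a j)

/-- `s ∈ [X]`: `s` is the union of the blocks `X i` for `i` in some nonempty finite set. -/
def InUnions (X : ℕ → Finset ℕ) (s : Finset ℕ) : Prop :=
  ∃ I : Finset ℕ, I.Nonempty ∧ s = I.biUnion X

/-- `Y ≤ X`: `Y` is a condensation of `X`, i.e. every block of `Y` is in `[X]`. -/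
def Condensation (Y X : ℕ → Finset ℕ) : Prop := ∀ n, InUnions X (Y n)

/-- `Y ≤* X`: some tail of `Y` (all blocks whose elements exceed some `m`)
is a condensation of `X`. -/
def CondensationStar (Y X : ℕ → Finset ℕ) : Prop :=
  ∃ m : ℕ, ∀ i, (∀ a ∈ Y i, m < a) → InUnions X (Y i)

/-- A nonempty family `H ⊆ FIN^[∞]` is Matet-adequate. -/
def MatetAdequate (H : Set (ℕ → Finset ℕ)) : Prop :=
  H.Nonempty ∧
  (∀ X ∈ H, IsBlockSeq X) ∧
  -- (i) closed under finite changes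
  (∀ Y ∈ H, ∀ X : ℕ → Finset ℕ, IsBlockSeq X → {n | X n ≠ Y n}.Finite → X ∈ H) ∧
  -- (ii) closed ≤*-upwards
  (∀ Y ∈ H, ∀ X : ℕ → Finset ℕ, IsBlockSeq X → CondensationStar Y X → X ∈ H) ∧
  -- (iii) ≤-descending sequences have ≤*-lower bounds in H
  (∀ f : ℕ → ℕ → Finset ℕ, (∀ n, f n ∈ H) → (∀ n, Condensation (f (n + 1)) (f n)) →
    ∃ X ∈ H, ∀ n, CondensationStar X (f n)) ∧
  -- (iv) Hindman property relative to H
  (∀ X ∈ H, ∀ c : Finset ℕ → Fin 2, ∃ Y ∈ H, Condensation Y X ∧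
    ∃ j : Fin 2, ∀ s : Finset ℕ, InUnions Y s → c s = j)

open Filter

/-- There is an ultrafilter on `Finset ℕ` that is idempotent for unions and concentrates on
nonempty sets with arbitrarily large minimum. -/
theorem exists_union_idempotent_ultrafilter :
    ∃ U : Ultrafilter (Finset ℕ),
      (∀ k : ℕ, ∀ᶠ s : Finset ℕ in U, s.Nonempty ∧ ∀ a ∈ s, k < a) ∧
      ∀ p : Finset ℕ → Prop, (∀ᶠ s in U, p s) → ∀ᶠ s in U, ∀ᶠ t in U, p (s ∪ t) := by
  let _ : Semigroup (Finset ℕ) := { mul := (· ∪ ·), mul_assoc := Finset.union_assoc }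
  let _ : Semigroup (Ultrafilter (Finset ℕ)) := Ultrafilter.semigroup
  let S : Set (Ultrafilter (Finset ℕ)) :=
    ⋂ k : ℕ, {U | ∀ᶠ s : Finset ℕ in U, s.Nonempty ∧ ∀ a ∈ s, k < a}
  obtain ⟨U, hU, hidem⟩ := exists_idempotent_in_compact_subsemigroup
    Ultrafilter.continuous_mul_left S
    ⟨(hyperfilter ℕ).map fun n => {n}, by
      refine Set.mem_iInter.2 fun k => ?_
      change ∀ᶠ n in (hyperfilter ℕ : Filter ℕ), _
      have h : ∀ᶠ n in (hyperfilter ℕ : Filter ℕ), k < n :=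
        Nat.hyperfilter_le_atTop (eventually_gt_atTop k)
      filter_upwards [h] with n hn
      simpa using hn⟩
    (isClosed_iInter fun k => ultrafilter_isClosed_basic _).isCompact
    (by
      intro U hU V hV
      refine Set.mem_iInter.2 fun k => ?_
      refine (Ultrafilter.eventually_mul U V _).2 ?_
      filter_upwards [Set.mem_iInter.1 hU k] with s hs
      filter_upwards [Set.mem_iInter.1 hV k] with t ht
      refine ⟨hs.1.mono Finset.subset_union_left, fun a ha => ?_⟩
      exact (Finset.mem_union.1 ha).elim (hs.2 a) (ht.2 a))
  refine ⟨U, fun k => Set.mem_iInter.1 hU k, fun p hp => ?_⟩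
  rw [← hidem] at hp
  exact (Ultrafilter.eventually_mul U U p).1 hp

/-- A map into a finite type is constant on a large set of an ultrafilter. -/
theorem Ultrafilter.exists_eventually_eq {α β : Type*} [Finite β] (U : Ultrafilter α)
    (f : α → β) : ∃ j, ∀ᶠ s in U, f s = j := by
  obtain ⟨j, hj⟩ := (U.map f).eq_pure_of_finite
  refine ⟨j, ?_⟩
  have h : {j} ∈ U.map f := by rw [hj]; exact Set.mem_singleton j
  exact h

/-- The `U`-limit of the colors `c (s_k :: ⋯ :: s_1 :: a)`, taken along `s_k`, …, `s_1`. -/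
noncomputable def ultraLim {α β : Type*} [Finite β] (U : Ultrafilter α) (c : List α → β) :
    ℕ → List α → β
  | 0, a => c a
  | k + 1, a => (U.exists_eventually_eq fun s => ultraLim U c k (s :: a)).choose

theorem eventually_ultraLim_cons {α β : Type*} [Finite β] (U : Ultrafilter α) (c : List α → β)
    (k : ℕ) (a : List α) : ∀ᶠ s in U, ultraLim U c k (s :: a) = ultraLim U c (k + 1) a := by
  rw [ultraLim]
  exact (U.exists_eventually_eq fun s => ultraLim U c k (s :: a)).choose_spec

/-- Finite sequences, listed backwards, all of whose entries up to the `n`-th keep the iterated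
limit color equal to `j`, as do their unions with almost every set. -/
def LimTree {β : Type*} (U : Ultrafilter (Finset ℕ)) (d : List (Finset ℕ) → β)
    (n : ℕ) (j : β) : List (Finset ℕ) → Prop
  | [] => True
  | s :: a => LimTree U d n j a ∧
      (a.length < n → d (s :: a) = j ∧ ∀ᶠ t in U, d ((s ∪ t) :: a) = j)

/-- If `U` is an idempotent ultrafilter and `T` is a family of (backwards) finite sequences that is
closed, for `U`-most sets, under appending the set and under enlarging the last entry by the set,
then `T` contains all finite block sequences from some infinite block sequence. -/
theorem exists_isBlockSeq_forall_mem (U : Ultrafilter (Finset ℕ))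
    (hU : ∀ k : ℕ, ∀ᶠ s : Finset ℕ in U, s.Nonempty ∧ ∀ a ∈ s, k < a)
    (T : List (Finset ℕ) → Prop) (hnil : T [])
    (hcons : ∀ a, T a → ∀ᶠ s in U, T (s :: a))
    (hunion : ∀ u a, T (u :: a) → ∀ᶠ s in U, T ((u ∪ s) :: a)) :
    ∃ X : ℕ → Finset ℕ, IsBlockSeq X ∧
      ∀ L : List (Finset ℕ), (∀ I ∈ L, I.Nonempty) → L.Pairwise (fun I J => blockLt J I) →
        T (L.map fun I => I.biUnion X) := by
  let next (F : Finset (List (Finset ℕ))) (s : Finset ℕ) : Finset (List (Finset ℕ)) :=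
    F ∪ F.image (s :: ·) ∪ F.image (List.modifyHead (· ∪ s))
  have step : ∀ p : {F : Finset (List (Finset ℕ)) // ∀ a ∈ F, T a} × ℕ,
      ∃ s : Finset ℕ, (s.Nonempty ∧ ∀ a ∈ s, p.2 < a) ∧ ∀ a ∈ next p.1.1 s, T a := by
    rintro ⟨⟨F, hF⟩, k⟩
    have h₁ : ∀ᶠ s in U, ∀ a ∈ F, T (s :: a) :=
      (Finset.eventually_all F).2 fun a ha => hcons a (hF a ha)
    have h₂ : ∀ᶠ s in U, ∀ a ∈ F, T (a.modifyHead (· ∪ s)) := by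
      refine (Finset.eventually_all F).2 fun a ha => ?_
      cases a with
      | nil => exact Eventually.of_forall fun s => hnil
      | cons u a => exact hunion u a (hF _ ha)
    obtain ⟨s, hs, hs₁, hs₂⟩ := ((hU k).and (h₁.and h₂)).exists
    refine ⟨s, hs, fun a ha => ?_⟩
    simp only [next, Finset.mem_union, Finset.mem_image] at ha
    rcases ha with (ha | ⟨b, hb, rfl⟩) | ⟨b, hb, rfl⟩
    exacts [hF a ha, hs₁ b hb, hs₂ b hb]
  choose f hf hfT using step
  let P : ℕ → {F : Finset (List (Finset ℕ)) // ∀ a ∈ F, T a} × ℕ := fun m =>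
    Nat.rec (⟨{[]}, by simpa using hnil⟩, 0)
      (fun _ p => (⟨next p.1.1 (f p), hfT p⟩, (f p).sup id)) m
  let X : ℕ → Finset ℕ := fun m => f (P m)
  have hP : ∀ m, (P (m + 1)).1.1 = next (P m).1.1 (X m) := fun m => rfl
  have hnilP : ∀ m, [] ∈ (P m).1.1 := by
    intro m
    induction m with
    | zero => exact Finset.mem_singleton_self _
    | succ m ih => rw [hP]; simp [next, ih]
  refine ⟨X, fun i => ⟨(hf _).1, fun a ha b hb => ?_⟩, ?_⟩
  · exact (Finset.le_sup (f := id) ha).trans_lt ((hf (P (i + 1))).2 b hb)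
  have key : ∀ m, ∀ L : List (Finset ℕ), (∀ I ∈ L, I.Nonempty) →
      L.Pairwise (fun I J => blockLt J I) → (∀ I ∈ L, ∀ i ∈ I, i < m) →
      (L.map fun I => I.biUnion X) ∈ (P m).1.1 := by
    intro m
    induction m with
    | zero =>
      intro L hne _ hlt
      cases L with
      | nil => exact hnilP 0
      | cons I L =>
        obtain ⟨i, hi⟩ := hne I List.mem_cons_self
        exact absurd (hlt I List.mem_cons_self i hi) (Nat.not_lt_zero i)
    | succ m ih =>
      intro L hne hL hlt
      rw [hP]
      cases L with
      | nil => simp [next, hnilP m]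
      | cons I L =>
        rw [List.pairwise_cons] at hL
        simp only [List.forall_mem_cons] at hne hlt
        have htail : ∀ J ∈ L, ∀ i ∈ J, i < m := by
          intro J hJ i hi
          obtain ⟨k, hk⟩ := hne.1
          have h₁ := hL.1 J hJ i hi k hk
          have h₂ := hlt.1 k hk
          omega
        simp only [next, Finset.mem_union, Finset.mem_image, List.map_cons]
        by_cases hm : m ∈ I
        · rcases (I.erase m).eq_empty_or_nonempty with he | he
          · left; right
            have hI : I = {m} := by rw [← Finset.insert_erase hm, he]; rfl
            exact ⟨_, ih L hne.2 hL.2 htail, by simp [hI]⟩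
          · right
            refine ⟨_, ih (I.erase m :: L) ?_ ?_ ?_, ?_⟩
            · exact List.forall_mem_cons.2 ⟨he, hne.2⟩
            · exact List.pairwise_cons.2
                ⟨fun J hJ i hi k hk => hL.1 J hJ i hi k (Finset.mem_of_mem_erase hk), hL.2⟩
            · refine List.forall_mem_cons.2 ⟨fun i hi => ?_, htail⟩
              have h₁ := hlt.1 i (Finset.mem_of_mem_erase hi)
              have h₂ := Finset.ne_of_mem_erase hi
              omega
            · have hI : I.biUnion X = (I.erase m).biUnion X ∪ X m := by
                conv_lhs => rw [← Finset.insert_erase hm]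
                rw [Finset.biUnion_insert, Finset.union_comm]
              simp [hI]
        · left; left
          refine ih (I :: L) (List.forall_mem_cons.2 hne) (List.pairwise_cons.2 hL)
            (List.forall_mem_cons.2 ⟨fun i hi => ?_, htail⟩)
          have h₁ := hlt.1 i hi
          have h₂ : i ≠ m := fun h => hm (h ▸ hi)
          omega
  intro L hne hL
  let m := (L.toFinset.biUnion id).sup id + 1
  refine (P m).1.2 _ (key m L hne hL fun I hI i hi => Nat.lt_succ_of_le ?_)
  exact Finset.le_sup (f := id) (Finset.mem_biUnion.2 ⟨I, List.mem_toFinset.2 hI, hi⟩)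

theorem IsBlockSeq.blockLt_of_lt {X : ℕ → Finset ℕ} (hX : IsBlockSeq X) {i j : ℕ} (hij : i < j) :
    blockLt (X i) (X j) := by
  induction j, hij using Nat.le_induction with
  | base => exact (hX i).2
  | succ j _ ih =>
    intro a ha b hb
    obtain ⟨k, hk⟩ := (hX j).1
    exact (ih a ha k hk).trans ((hX j).2 k hk b hb)

theorem IsBlockSeq.blockLt_of_biUnion {X : ℕ → Finset ℕ} (hX : IsBlockSeq X) {I J : Finset ℕ}
    (h : blockLt (I.biUnion X) (J.biUnion X)) : blockLt I J := by
  intro i hi j hj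
  obtain ⟨x, hx⟩ := (hX i).1
  obtain ⟨y, hy⟩ := (hX j).1
  by_contra! hji
  have hxI := Finset.mem_biUnion.2 ⟨i, hi, hx⟩
  rcases hji.eq_or_lt with rfl | hlt
  · exact (h x hxI x (Finset.mem_biUnion.2 ⟨j, hj, hx⟩)).false
  · exact (h x hxI y (Finset.mem_biUnion.2 ⟨j, hj, hy⟩)).asymm (hX.blockLt_of_lt hlt y hy x hx)

/-- Taylor's theorem. -/
theorem taylor (n r : ℕ) (hn : 0 < n) (hr : 0 < r)
    (c : (Fin n → Finset ℕ) → Fin r) :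
    ∃ X : ℕ → Finset ℕ, IsBlockSeq X ∧
      ∃ j : Fin r, ∀ a : Fin n → Finset ℕ, IsFinBlockSeq a →
        (∀ i, InUnions X (a i)) → c a = j := by
  obtain ⟨U, hU, hidem⟩ := exists_union_idempotent_ultrafilter
  let c' : List (Finset ℕ) → Fin r := fun l => c fun i => l.reverse.getD i ∅
  let d : List (Finset ℕ) → Fin r := fun a => ultraLim U c' (n - a.length) a
  let j := d []
  have hd : ∀ a, LimTree U d n j a → a.length ≤ n → d a = j := by
    intro a ha hlen
    cases a with
    | nil => rfl
    | cons s a => exact (ha.2 hlen).1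
  have hcons : ∀ a, LimTree U d n j a → ∀ᶠ s in U, LimTree U d n j (s :: a) := by
    intro a ha
    by_cases hlen : a.length < n
    · have h : ∀ᶠ s in U, d (s :: a) = j := by
        have hk : n - a.length = n - (a.length + 1) + 1 := by omega
        filter_upwards [eventually_ultraLim_cons U c' (n - (a.length + 1)) a] with s hs
        rw [← hd a ha hlen.le]
        simpa only [d, List.length_cons, hk] using hs
      filter_upwards [h, hidem _ h] with s hs hs'
      exact ⟨ha, fun _ => ⟨hs, hs'⟩⟩
    · exact Eventually.of_forall fun s => ⟨ha, fun h => absurd h hlen⟩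
  have hunion : ∀ u a, LimTree U d n j (u :: a) →
      ∀ᶠ s in U, LimTree U d n j ((u ∪ s) :: a) := by
    rintro u a ⟨ha, hu⟩
    by_cases hlen : a.length < n
    · filter_upwards [(hu hlen).2, hidem _ (hu hlen).2] with s hs hs'
      exact ⟨ha, fun _ => ⟨hs, by simpa only [Finset.union_assoc] using hs'⟩⟩
    · exact Eventually.of_forall fun s => ⟨ha, fun h => absurd h hlen⟩
  obtain ⟨X, hX, hXT⟩ :=
    exists_isBlockSeq_forall_mem U hU (LimTree U d n j) trivial hcons hunion
  refine ⟨X, hX, j, fun a ha haX => ?_⟩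
  choose I hI haI using haX
  have hT := hXT (List.ofFn I).reverse (by simpa [List.mem_ofFn] using hI) (by
    rw [List.pairwise_reverse, List.pairwise_ofFn]
    intro i k hik
    apply hX.blockLt_of_biUnion
    rw [← haI, ← haI]
    exact ha.2 i k hik)
  have hlist : ((List.ofFn I).reverse.map fun I => I.biUnion X) = (List.ofFn a).reverse := by
    rw [List.map_reverse, List.map_ofFn]
    congr 2
    funext i
    exact (haI i).symm
  rw [hlist] at hT
  have h := hd _ hT (by simp)
  simpa [d, c', ultraLim] using h
end

section
/- If U0 and U1 are two non-isomorphic Ramsey ultrafilters on ℕ, then for every X ∈ FIN^[∞](⟨U0,U1⟩) and every coloring c : [X] → {0,1} there exists Y ∈ FIN^[∞](⟨U0,U1⟩) with Y ≤ X such that c is constant on [Y]. -/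
/-- A (ultra)filter is free if it contains no finite set, equivalently
every member is infinite. -/
def FreeUf {S : Type} (U : Ultrafilter S) : Prop := ∀ A ∈ U, Set.Infinite A

/-- Isomorphism of ultrafilters: some bijection maps one to the other. -/
def UfIso {S T : Type} (U : Ultrafilter S) (V : Ultrafilter T) : Prop :=
  ∃ f : S ≃ T, Ultrafilter.map f U = V

/-- A Ramsey ultrafilter on ℕ: free, and every 2-coloring of pairs has a
monochromatic member. -/
def IsRamseyUf (U : Ultrafilter ℕ) : Prop :=
  FreeUf U ∧ ∀ c : ℕ → ℕ → Fin 2, ∃ A : Set ℕ, A ∈ U ∧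
    ∃ j : Fin 2, ∀ x ∈ A, ∀ y ∈ A, x < y → c x y = j

/-- A Q-point on ℕ: free, and for every partition of ℕ into finite sets
(encoded as a finite-to-one function, whose fibers are the pieces) there is a
member meeting each piece in at most one point. -/
def IsQPointUf (U : Ultrafilter ℕ) : Prop :=
  FreeUf U ∧ ∀ f : ℕ → ℕ, (∀ m, (f ⁻¹' {m}).Finite) →
    ∃ A : Set ℕ, A ∈ U ∧ Set.InjOn f A

/-- Mildenberger's family `FIN^[∞](⟨U0,U1⟩)`. -/
def FINinfPair (U0 U1 : Ultrafilter ℕ) : Set (ℕ → Finset ℕ) :=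
  {X | IsBlockSeq X ∧ ∀ A : Set ℕ, A ∈ U0 → ∀ B : Set ℕ, B ∈ U1 →
    ∃ Y : ℕ → Finset ℕ, ∃ hY : IsBlockSeq Y, Condensation Y X ∧
      ∀ n, (Y n).min' (hY n).1 ∈ A ∧ (Y n).max' (hY n).1 ∈ B}

open Filter

section BlockMinMax

/-- The least element of a nonempty finite set (and `0` for the empty set). -/
noncomputable def blockMin (s : Finset ℕ) : ℕ := sInf (s : Set ℕ)

/-- The greatest element of a nonempty finite set (and `0` for the empty set). -/
def blockMax (s : Finset ℕ) : ℕ := s.sup id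

theorem blockMin_mem {s : Finset ℕ} (hs : s.Nonempty) : blockMin s ∈ s :=
  Nat.sInf_mem (s := (s : Set ℕ)) hs

theorem blockMin_le {s : Finset ℕ} {a : ℕ} (ha : a ∈ s) : blockMin s ≤ a :=
  Nat.sInf_le (s := (s : Set ℕ)) ha

theorem le_blockMax {s : Finset ℕ} {a : ℕ} (ha : a ∈ s) : a ≤ blockMax s :=
  Finset.le_sup (f := id) ha

theorem blockMax_mem {s : Finset ℕ} (hs : s.Nonempty) : blockMax s ∈ s := by
  obtain ⟨a, ha, h⟩ := Finset.exists_mem_eq_sup s hs id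
  rw [blockMax, h]
  exact ha

theorem min'_eq_blockMin {s : Finset ℕ} (hs : s.Nonempty) : s.min' hs = blockMin s :=
  le_antisymm (Finset.min'_le _ _ (blockMin_mem hs)) (blockMin_le (Finset.min'_mem _ _))

theorem max'_eq_blockMax {s : Finset ℕ} (hs : s.Nonempty) : s.max' hs = blockMax s :=
  le_antisymm (le_blockMax (Finset.max'_mem _ _)) (Finset.le_max' _ _ (blockMax_mem hs))

theorem blockMin_le_blockMax {s : Finset ℕ} (hs : s.Nonempty) : blockMin s ≤ blockMax s :=
  blockMin_le (blockMax_mem hs)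

theorem blockLt_iff {s t : Finset ℕ} (hs : s.Nonempty) (ht : t.Nonempty) :
    blockLt s t ↔ blockMax s < blockMin t :=
  ⟨fun h => h _ (blockMax_mem hs) _ (blockMin_mem ht), fun h _ ha _ hb =>
    (le_blockMax ha).trans_lt (h.trans_le (blockMin_le hb))⟩

theorem blockMin_union {s t : Finset ℕ} (hs : s.Nonempty) (h : ∀ b ∈ t, blockMin s ≤ b) :
    blockMin (s ∪ t) = blockMin s := by
  refine le_antisymm (blockMin_le (Finset.mem_union_left _ (blockMin_mem hs))) ?_
  rcases Finset.mem_union.1 (blockMin_mem (s := s ∪ t) (hs.mono Finset.subset_union_left))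
    with h' | h'
  · exact blockMin_le h'
  · exact h _ h'

theorem blockMax_union {s t : Finset ℕ} (h : blockMax s ≤ blockMax t) :
    blockMax (s ∪ t) = blockMax t := by
  simp only [blockMax, Finset.sup_union] at *
  exact sup_eq_right.2 h

end BlockMinMax

section BlockSequences

theorem InUnions.union {X : ℕ → Finset ℕ} {s t : Finset ℕ} (hs : InUnions X s)
    (ht : InUnions X t) : InUnions X (s ∪ t) := by
  obtain ⟨I, hI, rfl⟩ := hs
  obtain ⟨J, hJ, rfl⟩ := ht
  exact ⟨I ∪ J, hI.mono Finset.subset_union_left, (Finset.union_biUnion).symm⟩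

theorem inUnions_block (X : ℕ → Finset ℕ) (i : ℕ) : InUnions X (X i) :=
  ⟨{i}, Finset.singleton_nonempty i, Finset.singleton_biUnion.symm⟩

theorem IsBlockSeq.nonempty {X : ℕ → Finset ℕ} (hX : IsBlockSeq X) {s : Finset ℕ}
    (hs : InUnions X s) : s.Nonempty := by
  obtain ⟨I, ⟨i, hi⟩, rfl⟩ := hs
  exact ((hX i).1).mono (Finset.subset_biUnion_of_mem X hi)

theorem isBlockSeq_of_blockMax_lt {X : ℕ → Finset ℕ} (hne : ∀ i, (X i).Nonempty)
    (h : ∀ i, blockMax (X i) < blockMin (X (i + 1))) : IsBlockSeq X :=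
  fun i => ⟨hne i, (blockLt_iff (hne i) (hne (i + 1))).2 (h i)⟩

theorem IsBlockSeq.blockMax_lt {X : ℕ → Finset ℕ} (hX : IsBlockSeq X) (i : ℕ) :
    blockMax (X i) < blockMin (X (i + 1)) :=
  (blockLt_iff (hX i).1 (hX (i + 1)).1).1 (hX i).2

theorem IsBlockSeq.strictMono_blockMin {X : ℕ → Finset ℕ} (hX : IsBlockSeq X) :
    StrictMono fun i => blockMin (X i) :=
  strictMono_nat_of_lt_succ fun i =>
    (blockMin_le_blockMax (hX i).1).trans_lt (hX.blockMax_lt i)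

theorem IsBlockSeq.strictMono_blockMax {X : ℕ → Finset ℕ} (hX : IsBlockSeq X) :
    StrictMono fun i => blockMax (X i) :=
  strictMono_nat_of_lt_succ fun i =>
    (hX.blockMax_lt i).trans_le (blockMin_le_blockMax (hX (i + 1)).1)

theorem IsBlockSeq.blockMin_blockMax_union {X : ℕ → Finset ℕ} (hX : IsBlockSeq X) {i j : ℕ}
    (h : blockMin (X i) ≤ blockMax (X j)) :
    blockMin (X i ∪ X j) = blockMin (X i) ∧ blockMax (X i ∪ X j) = blockMax (X j) := by
  have hij : i ≤ j := by
    by_contra! hji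
    have h₁ := hX.blockMax_lt j
    have h₂ := hX.strictMono_blockMin.monotone (Nat.succ_le_of_lt hji)
    simp only [Nat.succ_eq_add_one] at h₂
    omega
  exact ⟨blockMin_union (hX i).1 fun b hb =>
    (hX.strictMono_blockMin.monotone hij).trans (blockMin_le hb),
    blockMax_union (hX.strictMono_blockMax.monotone hij)⟩

/-- The minimum of a member of `[X]` is the minimum of some block of `X`. -/
theorem IsBlockSeq.exists_blockMin_eq {X : ℕ → Finset ℕ} (hX : IsBlockSeq X) {s : Finset ℕ}
    (hs : InUnions X s) : ∃ i, blockMin (X i) = blockMin s := by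
  have hmem := blockMin_mem (hX.nonempty hs)
  obtain ⟨I, -, rfl⟩ := hs
  obtain ⟨i, hi, h⟩ := Finset.mem_biUnion.1 hmem
  exact ⟨i, le_antisymm (blockMin_le h)
    (blockMin_le (Finset.mem_biUnion.2 ⟨i, hi, blockMin_mem (hX i).1⟩))⟩

theorem IsBlockSeq.exists_blockMax_eq {X : ℕ → Finset ℕ} (hX : IsBlockSeq X) {s : Finset ℕ}
    (hs : InUnions X s) : ∃ i, blockMax (X i) = blockMax s := by
  have hmem := blockMax_mem (hX.nonempty hs)
  obtain ⟨I, -, rfl⟩ := hs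
  obtain ⟨i, hi, h⟩ := Finset.mem_biUnion.1 hmem
  exact ⟨i, le_antisymm
    (le_blockMax (Finset.mem_biUnion.2 ⟨i, hi, blockMax_mem (hX i).1⟩)) (le_blockMax h)⟩

end BlockSequences

section Ramsey

theorem FreeUf.le_atTop {U : Ultrafilter ℕ} (hU : FreeUf U) : (U : Filter ℕ) ≤ atTop := by
  rw [← Nat.cofinite_eq_atTop]
  intro A hA
  by_contra h
  exact hU _ (Ultrafilter.compl_mem_iff_notMem.2 h) hA

theorem IsRamseyUf.exists_forall_lt {U : Ultrafilter ℕ} (hU : IsRamseyUf U)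
    {P : ℕ → ℕ → Prop} (hP : ∀ x, ∀ᶠ y in (U : Filter ℕ), P x y) :
    ∃ A ∈ U, ∀ x ∈ A, ∀ y ∈ A, x < y → P x y := by
  classical
  obtain ⟨A, hA, j, hj⟩ := hU.2 fun x y => if P x y then 1 else 0
  refine ⟨A, hA, fun x hx y hy hxy => ?_⟩
  obtain ⟨z, ⟨hz, hPz⟩, hxz⟩ := Ultrafilter.nonempty_of_mem
    (inter_mem (inter_mem hA (hP x)) (hU.1.le_atTop (Ioi_mem_atTop x)))
  replace hPz : P x z := hPz
  have h₁ := hj x hx z hz hxz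
  have h₂ := hj x hx y hy hxy
  by_contra hn
  rw [if_pos hPz] at h₁
  rw [if_neg hn, ← h₁] at h₂
  exact absurd h₂ (by decide)

/-- A set `A` in a free ultrafilter contains a set `B` of the ultrafilter with `A \ B` infinite. -/
theorem FreeUf.exists_subset_infinite_diff {U : Ultrafilter ℕ} (hU : FreeUf U) {A : Set ℕ}
    (hA : A ∈ U) : ∃ B ∈ U, B ⊆ A ∧ (A \ B).Infinite := by
  classical
  have hinf := hU A hA
  let E : Set ℕ := {x ∈ A | Even (Nat.count (· ∈ A) x)}
  have key : ∀ r : ℕ, ∀ S : Set ℕ, (∀ k, Nat.nth (· ∈ A) (2 * k + r) ∈ S) → S.Infinite := by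
    intro r S h
    refine Set.infinite_of_injective_forall_mem (f := fun k => Nat.nth (· ∈ A) (2 * k + r)) ?_ h
    intro k l hkl
    have := Nat.nth_injective hinf hkl
    omega
  have hcount : ∀ n, Nat.count (· ∈ A) (Nat.nth (· ∈ A) n) = n :=
    Nat.count_nth_of_infinite hinf
  have hmem : ∀ n, Nat.nth (· ∈ A) n ∈ A := Nat.nth_mem_of_infinite hinf
  rcases U.em (· ∈ E) with h | h
  · refine ⟨E, h, fun x hx => hx.1, key 1 _ fun k => ⟨hmem _, fun hx => ?_⟩⟩
    have := hx.2
    rw [hcount] at this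
    simp at this
  · refine ⟨A \ E, inter_mem hA h, Set.sdiff_subset, key 0 _ fun k => ⟨hmem _, fun hx => ?_⟩⟩
    exact hx.2 ⟨hmem _, by rw [hcount]; simp⟩

/-- A map which is injective on a set of a free ultrafilter `U` sends `U` to the same image as some
permutation does. -/
theorem FreeUf.exists_perm_map_eq {U : Ultrafilter ℕ} (hU : FreeUf U) {f : ℕ → ℕ} {A : Set ℕ}
    (hA : A ∈ U) (hf : Set.InjOn f A) :
    ∃ σ : Equiv.Perm ℕ, Ultrafilter.map σ U = Ultrafilter.map f U := by
  classical
  obtain ⟨B, hB, hBA, hinf⟩ := hU.exists_subset_infinite_diff hA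
  have h₁ : (Bᶜ).Infinite := hinf.mono fun x hx => hx.2
  have h₂ : ((f '' B)ᶜ).Infinite := by
    refine (hinf.image (hf.mono Set.sdiff_subset)).mono ?_
    rintro _ ⟨x, hx, rfl⟩ ⟨y, hy, hxy⟩
    exact hx.2 (hf (hBA hy) hx.1 hxy ▸ hy)
  have := h₁.to_subtype
  have := h₂.to_subtype
  obtain ⟨e⟩ : Nonempty (↥(Bᶜ) ≃ ↥((f '' B)ᶜ)) := nonempty_equiv_of_countable
  let g : {x // x ∈ B} ≃ {x // x ∈ f '' B} := Equiv.Set.imageOfInjOn f B (hf.mono hBA)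
  let σ : Equiv.Perm ℕ := Equiv.subtypeCongr g e
  have hσ : ∀ x ∈ B, σ x = f x := by
    intro x hx
    simp only [σ, Equiv.subtypeCongr, Equiv.trans_apply, Equiv.sumCompl_symm_apply_of_pos hx]
    rfl
  refine ⟨σ, Ultrafilter.coe_injective ?_⟩
  exact Filter.map_congr (mem_of_superset hB hσ)

theorem exists_forall_ne_of_not_ufIso {U V : Ultrafilter ℕ} (hU : FreeUf U) (hV : FreeUf V)
    (hne : ¬ UfIso U V) {f g : ℕ → ℕ} {A B : Set ℕ} (hA : A ∈ U) (hB : B ∈ V)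
    (hf : Set.InjOn f A) (hg : Set.InjOn g B) :
    ∃ A' ∈ U, ∃ B' ∈ V, ∀ a ∈ A', ∀ b ∈ B', f a ≠ g b := by
  have hmap : Ultrafilter.map f U ≠ Ultrafilter.map g V := by
    intro h
    obtain ⟨σ, hσ⟩ := hU.exists_perm_map_eq hA hf
    obtain ⟨τ, hτ⟩ := hV.exists_perm_map_eq hB hg
    refine hne ⟨σ.trans τ.symm, ?_⟩
    rw [Equiv.coe_trans, ← Ultrafilter.map_map, hσ, h, ← hτ, Ultrafilter.map_map,
      Equiv.symm_comp_self, Ultrafilter.map_id]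
  obtain ⟨S, hS, hS'⟩ : ∃ S ∈ Ultrafilter.map f U, S ∉ Ultrafilter.map g V := by
    by_contra! h
    exact hmap (Ultrafilter.eq_of_le fun S hS => by
      by_contra hn
      exact Ultrafilter.compl_mem_iff_notMem.1 (h _ (Ultrafilter.compl_mem_iff_notMem.2 hn)) hS)
  refine ⟨f ⁻¹' S, hS, g ⁻¹' Sᶜ, Ultrafilter.compl_mem_iff_notMem.2 hS', ?_⟩
  intro a ha b hb hab
  exact hb (show g b ∈ S from hab ▸ ha)

/-- Two non-isomorphic Ramsey ultrafilters have sets whose union is sparse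
with respect to a given monotone unbounded function. -/
theorem exists_sparse_of_not_ufIso {U V : Ultrafilter ℕ} (hU : IsRamseyUf U)
    (hV : IsRamseyUf V) (hne : ¬ UfIso U V) {p : ℕ → ℕ} (hp : Monotone p)
    (hp' : Tendsto p atTop atTop) :
    ∃ A ∈ U, ∃ B ∈ V, Disjoint A B ∧
      ∀ x ∈ A ∪ B, ∀ y ∈ A ∪ B, x < y → p x + 3 ≤ p y := by
  obtain ⟨A₀, hA₀, hA⟩ := hU.exists_forall_lt fun x =>
    hU.1.le_atTop (hp'.eventually_ge_atTop (p x + 3))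
  obtain ⟨B₀, hB₀, hB⟩ := hV.exists_forall_lt fun x =>
    hV.1.le_atTop (hp'.eventually_ge_atTop (p x + 3))
  have inj : ∀ {S : Set ℕ} (d : ℕ), (∀ x ∈ S, ∀ y ∈ S, x < y → p x + 3 ≤ p y) →
      Set.InjOn (fun x => p x + d) S := by
    intro S d hS x hx y hy hxy
    simp only [add_left_inj] at hxy
    rcases lt_trichotomy x y with h | h | h
    · have := hS x hx y hy h
      omega
    · exact h
    · have := hS y hy x hx h
      omega
  have sep : ∀ i j : ℕ, ∃ A' ∈ U, ∃ B' ∈ V, ∀ a ∈ A', ∀ b ∈ B', p a + i ≠ p b + j :=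
    fun i j => exists_forall_ne_of_not_ufIso hU.1 hV.1 hne hA₀ hB₀ (inj i hA) (inj j hB)
  choose F hF G hG hFG using sep
  have hA' : ∀ᶠ a in (U : Filter ℕ), a ∈ A₀ ∧ ∀ i < 3, ∀ j < 3, a ∈ F i j :=
    Filter.Eventually.and hA₀ ((eventually_all_finite (Set.finite_Iio 3)).2 fun i _ =>
      (eventually_all_finite (Set.finite_Iio 3)).2 fun j _ => hF i j)
  have hB' : ∀ᶠ b in (V : Filter ℕ), b ∈ B₀ ∧ ∀ i < 3, ∀ j < 3, b ∈ G i j :=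
    Filter.Eventually.and hB₀ ((eventually_all_finite (Set.finite_Iio 3)).2 fun i _ =>
      (eventually_all_finite (Set.finite_Iio 3)).2 fun j _ => hG i j)
  have far : ∀ a, (a ∈ A₀ ∧ ∀ i < 3, ∀ j < 3, a ∈ F i j) →
      ∀ b, (b ∈ B₀ ∧ ∀ i < 3, ∀ j < 3, b ∈ G i j) → p a + 3 ≤ p b ∨ p b + 3 ≤ p a := by
    intro a ha b hb
    by_contra! h
    refine hFG (p b - p a) (p a - p b) a (ha.2 _ ?_ _ ?_) b (hb.2 _ ?_ _ ?_) ?_ <;> omega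
  refine ⟨_, hA', _, hB', ?_, ?_⟩
  · refine Set.disjoint_left.2 fun x hx hx' => ?_
    have := far x hx x hx'
    omega
  · rintro x (hx | hx) y (hy | hy) hxy
    · exact hA x hx.1 y hy.1 hxy
    · have := far x hx y hy
      have := hp hxy.le
      omega
    · have := far y hy x hx
      have := hp hxy.le
      omega
    · exact hB x hx.1 y hy.1 hxy

end Ramsey

section Selection

/-- A strictly increasing sequence starting at `0` divides `ℕ` into intervals. -/
theorem exists_interval_index {e : ℕ → ℕ} (he : StrictMono e) (he0 : e 0 = 0) :
    ∃ p : ℕ → ℕ, Monotone p ∧ Tendsto p atTop atTop ∧ ∀ x, e (p x) ≤ x ∧ x < e (p x + 1) := by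
  have hex : ∀ x, ∃ n, e n ≤ x ∧ x < e (n + 1) := by
    intro x
    refine ⟨Nat.findGreatest (fun n => e n ≤ x) x, ?_, ?_⟩
    · exact Nat.findGreatest_spec (P := fun n => e n ≤ x) (Nat.zero_le x) (by simp [he0])
    · by_contra! h
      have h₁ := Nat.le_findGreatest (P := fun n => e n ≤ x) ((he.le_apply).trans h) h
      omega
  choose p hp using hex
  have mono : ∀ {n x}, e n ≤ x → n ≤ p x := fun {n x} h =>
    Nat.lt_succ_iff.1 (he.lt_iff_lt.1 (h.trans_lt (hp x).2))
  exact ⟨p, fun x y hxy => mono ((hp x).1.trans hxy),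
    tendsto_atTop.2 fun n => (eventually_ge_atTop (e n)).mono fun x hx => mono hx, hp⟩

/-- The diagonalization: blocks can be selected one after the other so that their minima
and maxima form sets of the two ultrafilters. -/
theorem exists_block_selection {U V : Ultrafilter ℕ} (hU : IsRamseyUf U)
    (hV : IsRamseyUf V) (hne : ¬ UfIso U V) {D : ℕ → Set (Finset ℕ)} (hD : Antitone D)
    (hUV : ∀ n, ∀ᶠ a in (U : Filter ℕ), ∀ᶠ b in (V : Filter ℕ),
      ∃ s ∈ D n, blockMin s = a ∧ blockMax s = b) :
    ∃ Y : ℕ → Finset ℕ, Y 0 ∈ D 0 ∧ (∀ k, Y (k + 1) ∈ D (blockMax (Y k))) ∧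
      (Set.range fun k => blockMin (Y k)) ∈ U ∧ (Set.range fun k => blockMax (Y k)) ∈ V := by
  let P : ℕ → ℕ → Prop := fun n a => ∀ᶠ b in (V : Filter ℕ),
    ∃ s ∈ D n, blockMin s = a ∧ blockMax s = b
  let Q : ℕ → ℕ → Prop := fun n b => ∃ s ∈ D n, blockMax s = b
  have hQ : ∀ n, ∀ᶠ b in (V : Filter ℕ), Q n b := fun n => by
    obtain ⟨a, ha⟩ := (hUV n).exists
    exact ha.mono fun b ⟨s, hs, _, h⟩ => ⟨s, hs, h⟩
  obtain ⟨A, hA, hAP⟩ := hU.exists_forall_lt hUV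
  obtain ⟨B, hB, hBQ⟩ := hV.exists_forall_lt hQ
  obtain ⟨f, hfm, hf⟩ : ∃ f : ℕ → ℕ, StrictMono f ∧ ∀ m, m < f m ∧ (∃ x ∈ A, m ≤ x ∧ x < f m) ∧
      (∃ x ∈ B, m ≤ x ∧ x < f m) ∧
      ∀ n ≤ m, ∀ a ≤ m, P n a → ∃ s ∈ D n, blockMin s = a ∧ blockMax s ≤ f m := by
    refine extraction_forall_of_eventually' (P := fun m k => m < k ∧
      (∃ x ∈ A, m ≤ x ∧ x < k) ∧ (∃ x ∈ B, m ≤ x ∧ x < k) ∧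
      ∀ n ≤ m, ∀ a ≤ m, P n a → ∃ s ∈ D n, blockMin s = a ∧ blockMax s ≤ k) fun m => ?_
    rw [← eventually_atTop]
    have hS : ∀ {W : Ultrafilter ℕ}, FreeUf W → ∀ {S : Set ℕ}, S ∈ W →
        ∀ᶠ k in atTop, ∃ x ∈ S, m ≤ x ∧ x < k := by
      intro W hW S hS
      obtain ⟨x, hx, hmx⟩ := Ultrafilter.nonempty_of_mem
        (inter_mem hS (hW.le_atTop (Ici_mem_atTop m)))
      exact (eventually_gt_atTop x).mono fun k hk => ⟨x, hx, hmx, hk⟩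
    refine (eventually_gt_atTop m).and ((hS hU.1 hA).and ((hS hV.1 hB).and ?_))
    refine (eventually_all_finite (Set.finite_Iic m)).2 fun n _ =>
      (eventually_all_finite (Set.finite_Iic m)).2 fun a _ => ?_
    by_cases hP : P n a
    · obtain ⟨b, s, hs, ha, hb⟩ := hP.exists
      exact (eventually_ge_atTop b).mono fun k hk _ => ⟨s, hs, ha, hb.trans_le hk⟩
    · exact Eventually.of_forall fun k h => absurd h hP
  have hAf : ∀ n, ∀ a ∈ A, f n ≤ a → P n a := fun n a ha hna => by
    obtain ⟨x, hx, hnx, hxf⟩ := (hf n).2.1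
    exact (hAP x hx a ha (hxf.trans_le hna)).mono fun b ⟨s, hs, h⟩ => ⟨s, hD hnx hs, h⟩
  have hBf : ∀ n, ∀ b ∈ B, f n ≤ b → Q n b := fun n b hb hnb => by
    obtain ⟨x, hx, hnx, hxf⟩ := (hf n).2.2.1
    obtain ⟨s, hs, h⟩ := hBQ x hx b hb (hxf.trans_le hnb)
    exact ⟨s, hD hnx hs, h⟩
  let e : ℕ → ℕ := fun n => f^[n] 0
  have hes : ∀ n, e (n + 1) = f (e n) := fun n => Function.iterate_succ_apply' f n 0
  have hem : StrictMono e := strictMono_nat_of_lt_succ fun n => by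
    rw [hes]
    exact (hf _).1
  obtain ⟨p, hpm, hpt, hp⟩ := exists_interval_index hem rfl
  obtain ⟨A', hA', B', hB', hdisj, hsparse⟩ := exists_sparse_of_not_ufIso hU hV hne hpm hpt
  have large : ∀ {W : Ultrafilter ℕ}, FreeUf W → ∀ᶠ x in (W : Filter ℕ), 1 ≤ p x :=
    fun hW => hW.le_atTop (hpt.eventually_ge_atTop 1)
  let A₁ : Set ℕ := {x | (x ∈ A ∧ x ∈ A') ∧ 1 ≤ p x}
  let B₁ : Set ℕ := {x | (x ∈ B ∧ x ∈ B') ∧ 1 ≤ p x}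
  have hA₁ : A₁ ∈ U := (Filter.Eventually.and hA hA').and (large hU.1)
  have hB₁ : B₁ ∈ V := (Filter.Eventually.and hB hB').and (large hV.1)
  have step : ∀ x, 1 ≤ p x → f (e (p x - 1)) ≤ x := fun x hx => by
    rw [← hes, Nat.sub_add_cancel hx]
    exact (hp x).1
  have hblock : ∀ x ∈ A₁ ∪ B₁, ∃ s ∈ D (e (p x - 1)), blockMax s ≤ e (p x + 2) ∧
      (x ∈ A₁ → blockMin s = x) ∧ (x ∈ B₁ → blockMax s = x) := by
    rintro x (hx | hx)
    · have hle : e (p x - 1) ≤ x := (hem.monotone (Nat.sub_le _ _)).trans (hp x).1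
      obtain ⟨s, hs, hmin, hmax⟩ :=
        (hf x).2.2.2 _ hle x le_rfl (hAf _ x hx.1.1 (step x hx.2))
      refine ⟨s, hs, hmax.trans ?_, fun _ => hmin, fun h =>
        absurd h.1.2 (Set.disjoint_left.1 hdisj hx.1.2)⟩
      rw [hes]
      exact hfm.monotone (hp x).2.le
    · obtain ⟨s, hs, hmax⟩ := hBf _ x hx.1.1 (step x hx.2)
      refine ⟨s, hs, hmax.trans_le ((hp x).2.le.trans (hem.monotone (by omega))), fun h =>
        absurd hx.1.2 (Set.disjoint_left.1 hdisj h.1.2), fun _ => hmax⟩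
  choose! T hT hTmax hTA hTB using hblock
  have hinf : (A₁ ∪ B₁).Infinite := (hU.1 A₁ hA₁).mono Set.subset_union_left
  let y : ℕ → ℕ := Nat.nth (· ∈ A₁ ∪ B₁)
  have hy : ∀ k, y k ∈ A₁ ∪ B₁ := Nat.nth_mem_of_infinite hinf
  have hys : ∀ x ∈ A₁ ∪ B₁, ∃ k, y k = x := fun x hx => by
    have := Nat.range_nth_of_infinite (p := (· ∈ A₁ ∪ B₁)) hinf
    exact this.symm.subset hx
  refine ⟨fun k => T (y k), hD (Nat.zero_le _) (hT _ (hy 0)), fun k => ?_, ?_, ?_⟩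
  · have hlt : y k < y (k + 1) := Nat.nth_strictMono hinf k.lt_succ_self
    have mem : ∀ k, y k ∈ A' ∪ B' := fun k => (hy k).imp (fun h => h.1.2) fun h => h.1.2
    have := hsparse _ (mem k) _ (mem (k + 1)) hlt
    exact hD ((hTmax _ (hy k)).trans (hem.monotone (by omega))) (hT _ (hy (k + 1)))
  · refine mem_of_superset hA₁ fun x hx => ?_
    obtain ⟨k, rfl⟩ := hys x (Or.inl hx)
    exact ⟨k, hTA _ (Or.inl hx) hx⟩
  · refine mem_of_superset hB₁ fun x hx => ?_
    obtain ⟨k, rfl⟩ := hys x (Or.inr hx)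
    exact ⟨k, hTB _ (Or.inr hx) hx⟩

end Selection

section Membership

theorem blockMin_range_mem_of_mem_FINinfPair {U V : Ultrafilter ℕ} {X : ℕ → Finset ℕ}
    (hX : X ∈ FINinfPair U V) : (Set.range fun i => blockMin (X i)) ∈ U := by
  by_contra h
  obtain ⟨Y, hY, hYX, hAB⟩ := hX.2 _ (Ultrafilter.compl_mem_iff_notMem.2 h) Set.univ univ_mem
  refine (hAB 0).1 ?_
  rw [min'_eq_blockMin]
  exact hX.1.exists_blockMin_eq (hYX 0)

theorem blockMax_range_mem_of_mem_FINinfPair {U V : Ultrafilter ℕ} {X : ℕ → Finset ℕ}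
    (hX : X ∈ FINinfPair U V) : (Set.range fun i => blockMax (X i)) ∈ V := by
  by_contra h
  obtain ⟨Y, hY, hYX, hAB⟩ := hX.2 Set.univ univ_mem _ (Ultrafilter.compl_mem_iff_notMem.2 h)
  refine (hAB 0).2 ?_
  rw [max'_eq_blockMax]
  exact hX.1.exists_blockMax_eq (hYX 0)

theorem mem_FINinfPair_of_range_mem {U V : Ultrafilter ℕ} (hU : FreeUf U) (hV : FreeUf V)
    {X : ℕ → Finset ℕ} (hX : IsBlockSeq X) (hmin : (Set.range fun i => blockMin (X i)) ∈ U)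
    (hmax : (Set.range fun i => blockMax (X i)) ∈ V) : X ∈ FINinfPair U V := by
  refine ⟨hX, fun A hA B hB => ?_⟩
  have hex : ∀ N : ℕ, ∃ s, InUnions X s ∧ N < blockMin s ∧ blockMin s ∈ A ∧ blockMax s ∈ B := by
    intro N
    obtain ⟨_, ⟨ha, i, rfl⟩, haN⟩ := Ultrafilter.nonempty_of_mem
      (inter_mem (inter_mem hA hmin) (hU.le_atTop (Ioi_mem_atTop N)))
    obtain ⟨_, ⟨hb, j, rfl⟩, hab⟩ := Ultrafilter.nonempty_of_mem
      (inter_mem (inter_mem hB hmax) (hV.le_atTop (Ioi_mem_atTop (blockMin (X i)))))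
    obtain ⟨h₁, h₂⟩ := hX.blockMin_blockMax_union (le_of_lt hab)
    refine ⟨X i ∪ X j, (inUnions_block X i).union (inUnions_block X j), ?_⟩
    rw [h₁, h₂]
    exact ⟨haN, ha, hb⟩
  choose F hF hFmin hFA hFB using hex
  let N : ℕ → ℕ := fun n => (fun m => blockMax (F m))^[n] 0
  have hN : ∀ n, N (n + 1) = blockMax (F (N n)) :=
    fun n => Function.iterate_succ_apply' (fun m => blockMax (F m)) n 0
  have hY : IsBlockSeq fun n => F (N n) := isBlockSeq_of_blockMax_lt
    (fun n => hX.nonempty (hF _)) fun n => by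
      rw [← hN]
      exact hFmin _
  refine ⟨_, hY, fun n => hF _, fun n => ?_⟩
  rw [min'_eq_blockMin, max'_eq_blockMax]
  exact ⟨hFA _, hFB _⟩

end Membership

section Idempotent

/-- The ultrafilters concentrated on `[X]` whose image under `(min, max)` is the
product of `U` and `V`. -/
def minMaxUltrafilters (U V : Ultrafilter ℕ) (X : ℕ → Finset ℕ) :
    Set (Ultrafilter (Finset ℕ)) :=
  {W | (∀ᶠ s in (W : Filter (Finset ℕ)), InUnions X s) ∧
    ∀ P : ℕ → ℕ → Prop, (∀ᶠ a in (U : Filter ℕ), ∀ᶠ b in (V : Filter ℕ), P a b) →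
      ∀ᶠ s in (W : Filter (Finset ℕ)), P (blockMin s) (blockMax s)}

theorem isClosed_minMaxUltrafilters (U V : Ultrafilter ℕ) (X : ℕ → Finset ℕ) :
    IsClosed (minMaxUltrafilters U V X) := by
  have h : minMaxUltrafilters U V X = {W | {s | InUnions X s} ∈ W} ∩
      ⋂ P : ℕ → ℕ → Prop, ⋂ _ : ∀ᶠ a in (U : Filter ℕ), ∀ᶠ b in (V : Filter ℕ), P a b,
        {W | {s | P (blockMin s) (blockMax s)} ∈ W} := by
    ext W
    simp only [Set.mem_inter_iff, Set.mem_iInter]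
    rfl
  rw [h]
  exact (ultrafilter_isClosed_basic _).inter
    (isClosed_iInter fun P => isClosed_iInter fun _ => ultrafilter_isClosed_basic _)

theorem minMaxUltrafilters_nonempty {U V : Ultrafilter ℕ} (hV : FreeUf V)
    {X : ℕ → Finset ℕ} (hX : X ∈ FINinfPair U V) : (minMaxUltrafilters U V X).Nonempty := by
  have hmin := blockMin_range_mem_of_mem_FINinfPair hX
  have hmax := blockMax_range_mem_of_mem_FINinfPair hX
  let i : ℕ → ℕ := Function.invFun fun i => blockMin (X i)
  let j : ℕ → ℕ := Function.invFun fun i => blockMax (X i)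
  let W : Ultrafilter (Finset ℕ) := U.bind fun a => V.map fun b => X (i a) ∪ X (j b)
  have hW : ∀ p : Finset ℕ → Prop, (∀ᶠ s in (W : Filter (Finset ℕ)), p s) ↔
      ∀ᶠ a in (U : Filter ℕ), ∀ᶠ b in (V : Filter ℕ), p (X (i a) ∪ X (j b)) := fun p => Iff.rfl
  refine ⟨W, ?_, fun P hP => ?_⟩
  · exact (hW _).2 (Eventually.of_forall fun a => Eventually.of_forall fun b =>
      (inUnions_block X _).union (inUnions_block X _))
  · refine (hW _).2 ?_
    filter_upwards [hP, hmin] with a haP ha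
    filter_upwards [haP, hmax, hV.le_atTop (Ioi_mem_atTop a)] with b hab hb hlt
    have ha' : blockMin (X (i a)) = a := Function.invFun_eq (f := fun i => blockMin (X i)) ha
    have hb' : blockMax (X (j b)) = b := Function.invFun_eq (f := fun i => blockMax (X i)) hb
    obtain ⟨h₁, h₂⟩ := hX.1.blockMin_blockMax_union (i := i a) (j := j b)
      (by rw [ha', hb']; exact le_of_lt hlt)
    rwa [h₁, h₂, ha', hb']

theorem eventually_lt_blockMin {U V : Ultrafilter ℕ} (hU : FreeUf U) {X : ℕ → Finset ℕ}
    {W : Ultrafilter (Finset ℕ)} (hW : W ∈ minMaxUltrafilters U V X) (n : ℕ) :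
    ∀ᶠ s in (W : Filter (Finset ℕ)), n < blockMin s :=
  hW.2 (fun a _ => n < a) (mem_of_superset (hU.le_atTop (Ioi_mem_atTop n)) fun _ ha =>
    Eventually.of_forall fun _ => ha)

theorem exists_idempotent_minMaxUltrafilter {U V : Ultrafilter ℕ} (hU : FreeUf U)
    (hV : FreeUf V) {X : ℕ → Finset ℕ} (hX : X ∈ FINinfPair U V) :
    ∃ W ∈ minMaxUltrafilters U V X, ∀ p : Finset ℕ → Prop,
      (∀ᶠ s in (W : Filter (Finset ℕ)), p s) →
        ∀ᶠ s in (W : Filter (Finset ℕ)), ∀ᶠ t in (W : Filter (Finset ℕ)), p (s ∪ t) := by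
  let _ : Semigroup (Finset ℕ) := { mul := (· ∪ ·), mul_assoc := Finset.union_assoc }
  let _ : Semigroup (Ultrafilter (Finset ℕ)) := Ultrafilter.semigroup
  have hmul : ∀ W₁ ∈ minMaxUltrafilters U V X, ∀ W₂ ∈ minMaxUltrafilters U V X,
      W₁ * W₂ ∈ minMaxUltrafilters U V X := by
    intro W₁ h₁ W₂ h₂
    refine ⟨(Ultrafilter.eventually_mul W₁ W₂ _).2 ?_, fun P hP =>
      (Ultrafilter.eventually_mul W₁ W₂ _).2 ?_⟩
    · filter_upwards [h₁.1] with s hs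
      filter_upwards [h₂.1] with t ht
      exact hs.union ht
    · have hP₁ := h₁.2 (fun a _ => ∀ᶠ b in (V : Filter ℕ), P a b)
        (hP.mono fun a ha => Eventually.of_forall fun _ => ha)
      filter_upwards [hP₁, h₁.1] with s hs hsX
      have hP₂ := h₂.2 (fun _ b => P (blockMin s) b) (Eventually.of_forall fun _ => hs)
      filter_upwards [hP₂, eventually_lt_blockMin hU h₂ (blockMax s), h₂.1] with t ht hst htX
      have hs' := hX.1.nonempty hsX
      have ht' := hX.1.nonempty htX
      have hle : blockMin s ≤ blockMin t := (blockMin_le_blockMax hs').trans hst.le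
      change P (blockMin (s ∪ t)) (blockMax (s ∪ t))
      rwa [blockMin_union hs' fun b hb => hle.trans (blockMin_le hb),
        blockMax_union (hst.le.trans (blockMin_le_blockMax ht'))]
  obtain ⟨W, hW, hidem⟩ := exists_idempotent_in_compact_subsemigroup
    (Ultrafilter.continuous_mul_left (M := Finset ℕ)) (minMaxUltrafilters U V X)
    (minMaxUltrafilters_nonempty hV hX) (isClosed_minMaxUltrafilters U V X).isCompact hmul
  refine ⟨W, hW, fun p hp => ?_⟩
  rw [← hidem] at hp
  exact (Ultrafilter.eventually_mul W W p).1 hp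

end Idempotent

section Homogeneity

/-- If every block can be appended to all unions of earlier blocks lying in `S`,
then all unions lie in `S`. -/
theorem inUnions_subset_of_forall_append {S : Set (Finset ℕ)} {Y : ℕ → Finset ℕ}
    (hY : IsBlockSeq Y) (hYS : ∀ k, Y k ∈ S)
    (h : ∀ k, ∀ s ⊆ Finset.range (blockMax (Y k) + 1), s ∈ S → s ∪ Y (k + 1) ∈ S)
    {s : Finset ℕ} (hs : InUnions Y s) : s ∈ S := by
  obtain ⟨I, hI, rfl⟩ := hs
  induction I using Finset.induction_on_max with
  | empty => exact absurd hI Finset.not_nonempty_empty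
  | insert a I hlt ih =>
    rcases I.eq_empty_or_nonempty with rfl | hne
    · simpa using hYS a
    · obtain ⟨i, hi⟩ := hne
      obtain ⟨k, rfl⟩ := Nat.exists_eq_succ_of_ne_zero (Nat.ne_zero_of_lt (hlt i hi))
      rw [Finset.biUnion_insert, Finset.union_comm]
      refine h k _ (fun x hx => ?_) (ih ⟨i, hi⟩)
      obtain ⟨l, hl, hxl⟩ := Finset.mem_biUnion.1 hx
      exact Finset.mem_range_succ_iff.2 ((le_blockMax hxl).trans
        (hY.strictMono_blockMax.monotone (Nat.lt_succ_iff.1 (hlt l hl))))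

end Homogeneity

/-- The Hindman property of `FIN^[∞](⟨U0,U1⟩)`. -/
theorem fininfPair_hindman (U0 U1 : Ultrafilter ℕ)
    (h0 : IsRamseyUf U0) (h1 : IsRamseyUf U1) (hne : ¬ UfIso U0 U1)
    (X : ℕ → Finset ℕ) (hX : X ∈ FINinfPair U0 U1) (c : Finset ℕ → Fin 2) :
    ∃ Y ∈ FINinfPair U0 U1, Condensation Y X ∧
      ∃ j : Fin 2, ∀ s : Finset ℕ, InUnions Y s → c s = j := by
  obtain ⟨W, hW, hidem⟩ := exists_idempotent_minMaxUltrafilter h0.1 h1.1 hX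
  obtain ⟨j, hj⟩ : ∃ j : Fin 2, ∀ᶠ s in (W : Filter (Finset ℕ)), c s = j := by
    rcases W.em (fun s => c s = 0) with h | h
    · exact ⟨0, h⟩
    · exact ⟨1, h.mono fun s hs => by omega⟩
  let q : Finset ℕ → Prop := fun s => InUnions X s ∧ c s = j
  have hq : ∀ᶠ s in (W : Filter (Finset ℕ)), q s := hW.1.and hj
  let S : Set (Finset ℕ) := {s | q s ∧ ∀ᶠ t in (W : Filter (Finset ℕ)), q (s ∪ t)}
  have hS : ∀ᶠ s in (W : Filter (Finset ℕ)), s ∈ S := hq.and (hidem q hq)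
  have hSS : ∀ s ∈ S, ∀ᶠ t in (W : Filter (Finset ℕ)), s ∪ t ∈ S := fun s hs =>
    hs.2.and ((hidem _ hs.2).mono fun t ht => ht.mono fun u hu => by
      rwa [Finset.union_assoc])
  let D : ℕ → Set (Finset ℕ) := fun n => {t | t ∈ S ∧ n < blockMin t ∧
    ∀ s ⊆ Finset.range (n + 1), s ∈ S → s ∪ t ∈ S}
  have hD : Antitone D := fun m n hmn t ht => ⟨ht.1, hmn.trans_lt ht.2.1, fun s hs =>
    ht.2.2 s (hs.trans (Finset.range_subset_range.2 (Nat.succ_le_succ hmn)))⟩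
  have hDW : ∀ n, ∀ᶠ t in (W : Filter (Finset ℕ)), t ∈ D n := fun n => by
    refine hS.and ((eventually_lt_blockMin h0.1 hW n).and ?_)
    have := (eventually_all_finset (l := (W : Filter (Finset ℕ)))
      (p := fun s t => s ∈ S → s ∪ t ∈ S) (Finset.range (n + 1)).powerset).2 fun s _ => by
        by_cases hs : s ∈ S
        · exact (hSS s hs).mono fun t ht _ => ht
        · exact Eventually.of_forall fun t h => absurd h hs
    exact this.mono fun t ht s hs => ht s (Finset.mem_powerset.2 hs)
  obtain ⟨Y, hY0, hYs, hmin, hmax⟩ := exists_block_selection h0 h1 hne hD fun n => by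
    by_contra h
    rw [← Ultrafilter.eventually_not] at h
    have h' := hW.2 (fun a b => ¬ ∃ s ∈ D n, blockMin s = a ∧ blockMax s = b)
      (h.mono fun a ha => Ultrafilter.eventually_not.2 ha)
    obtain ⟨s, hs, hsD⟩ := (h'.and (hDW n)).exists
    exact hs ⟨s, hsD, rfl, rfl⟩
  have hYS : ∀ k, Y k ∈ S := fun k => by
    cases k with
    | zero => exact hY0.1
    | succ k => exact (hYs k).1
  have hblock : IsBlockSeq Y := isBlockSeq_of_blockMax_lt
    (fun k => hX.1.nonempty (hYS k).1.1) fun k => (hYs k).2.1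
  refine ⟨Y, mem_FINinfPair_of_range_mem h0.1 h1.1 hblock hmin hmax, fun n => (hYS n).1.1, j,
    fun s hs => ?_⟩
  exact (inUnions_subset_of_forall_append hblock hYS (fun k => (hYs k).2.2) hs).1.2
end

section
/- If U0 and U1 are two non-isomorphic Ramsey ultrafilters on ℕ, then every ≤-descending sequence X_0 ≥ X_1 ≥ X_2 ≥ ⋯ of members of FIN^[∞](⟨U0,U1⟩) has a ≤*-lower bound in FIN^[∞](⟨U0,U1⟩): there is X ∈ FIN^[∞](⟨U0,U1⟩) with X ≤* X_n for all n. -/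
lemma InUnions.trans {X Y : ℕ → Finset ℕ} (h : Condensation Y X) {s : Finset ℕ}
    (hs : InUnions Y s) : InUnions X s := by
  obtain ⟨I, ⟨i₀, hi₀⟩, rfl⟩ := hs
  choose J hJ hY using h
  refine ⟨I.biUnion J, ?_, ?_⟩
  · obtain ⟨j, hj⟩ := hJ i₀
    exact ⟨j, Finset.mem_biUnion.2 ⟨i₀, hi₀, hj⟩⟩
  · rw [Finset.biUnion_biUnion]
    exact Finset.biUnion_congr rfl fun i _ => hY i

lemma InUnions.antitone {f : ℕ → ℕ → Finset ℕ} (hdesc : ∀ n, Condensation (f (n + 1)) (f n))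
    (s : Finset ℕ) : Antitone fun n => InUnions (f n) s :=
  antitone_nat_of_succ_le fun n hs => hs.trans (hdesc n)

lemma IsBlockSeq.lt {X : ℕ → Finset ℕ} (h : IsBlockSeq X) {i j : ℕ} (hij : i < j) :
    blockLt (X i) (X j) := by
  induction j, hij using Nat.le_induction with
  | base => exact (h i).2
  | succ j _ ih =>
    intro a ha b hb
    obtain ⟨c, hc⟩ := (h j).1
    exact (ih a ha c hc).trans ((h j).2 c hc b hb)

/-- The minima of the blocks of `X`. -/
def blockMins (X : ℕ → Finset ℕ) : Set ℕ := {a | ∃ i, IsLeast (X i : Set ℕ) a}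

/-- The maxima of the blocks of `X`. -/
def blockMaxs (X : ℕ → Finset ℕ) : Set ℕ := {a | ∃ i, IsGreatest (X i : Set ℕ) a}

lemma InUnions.least_mem {X : ℕ → Finset ℕ} {s : Finset ℕ} (hs : InUnions X s) {a : ℕ}
    (ha : IsLeast (s : Set ℕ) a) : a ∈ blockMins X := by
  obtain ⟨I, -, rfl⟩ := hs
  obtain ⟨i, hi, hai⟩ := Finset.mem_biUnion.1 ha.1
  exact ⟨i, hai, fun b hb => ha.2 (Finset.mem_biUnion.2 ⟨i, hi, hb⟩)⟩

lemma InUnions.greatest_mem {X : ℕ → Finset ℕ} {s : Finset ℕ} (hs : InUnions X s) {a : ℕ}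
    (ha : IsGreatest (s : Set ℕ) a) : a ∈ blockMaxs X := by
  obtain ⟨I, -, rfl⟩ := hs
  obtain ⟨i, hi, hai⟩ := Finset.mem_biUnion.1 ha.1
  exact ⟨i, hai, fun b hb => ha.2 (Finset.mem_biUnion.2 ⟨i, hi, hb⟩)⟩

lemma blockMins_antitone {f : ℕ → ℕ → Finset ℕ}
    (hdesc : ∀ n, Condensation (f (n + 1)) (f n)) : Antitone fun n => blockMins (f n) :=
  antitone_nat_of_succ_le fun n _ ⟨i, hi⟩ => (hdesc n i).least_mem hi

lemma blockMaxs_antitone {f : ℕ → ℕ → Finset ℕ}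
    (hdesc : ∀ n, Condensation (f (n + 1)) (f n)) : Antitone fun n => blockMaxs (f n) :=
  antitone_nat_of_succ_le fun n _ ⟨i, hi⟩ => (hdesc n i).greatest_mem hi

/-- A block minimum and a later block maximum are the minimum and maximum of a single union. -/
lemma IsBlockSeq.exists_inUnions {X : ℕ → Finset ℕ} (h : IsBlockSeq X) {a b : ℕ}
    (ha : a ∈ blockMins X) (hb : b ∈ blockMaxs X) (hab : a ≤ b) :
    ∃ s, InUnions X s ∧ IsLeast (s : Set ℕ) a ∧ IsGreatest (s : Set ℕ) b := by
  obtain ⟨i, hai, hi⟩ := ha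
  obtain ⟨j, hbj, hj⟩ := hb
  have hij : i ≤ j := by
    by_contra! hji
    exact absurd (h.lt hji b hbj a hai) (by omega)
  have hle : ∀ x ∈ X i, ∀ y ∈ X j, x ≤ b ∧ a ≤ y := by
    intro x hx y hy
    rcases hij.eq_or_lt with rfl | hlt
    · exact ⟨hj hx, hi hy⟩
    · exact ⟨(h.lt hlt x hx b hbj).le, (h.lt hlt a hai y hy).le⟩
  refine ⟨({i, j} : Finset ℕ).biUnion X, ⟨_, by simp, rfl⟩, ⟨?_, ?_⟩, ⟨?_, ?_⟩⟩
  · simpa using Or.inl hai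
  · intro y hy
    rcases (by simpa using hy : y ∈ X i ∨ y ∈ X j) with hy | hy
    exacts [hi hy, (hle a hai y hy).2]
  · simpa using Or.inr hbj
  · intro y hy
    rcases (by simpa using hy : y ∈ X i ∨ y ∈ X j) with hy | hy
    exacts [(hle y hy b hbj).1, hj hy]

lemma FreeUf.exists_gt {U : Ultrafilter ℕ} (h : FreeUf U) {A : Set ℕ} (hA : A ∈ U) (m : ℕ) :
    ∃ a ∈ A, m < a :=
  (h A hA).exists_gt m

lemma FreeUf.Ioi_mem {U : Ultrafilter ℕ} (h : FreeUf U) (m : ℕ) : Set.Ioi m ∈ U := by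
  rw [← Ultrafilter.compl_notMem_iff]
  intro hc
  exact h _ hc (by simp [Set.finite_Iic])

lemma mem_FINinfPair_iff {U0 U1 : Ultrafilter ℕ} (h0 : FreeUf U0) (h1 : FreeUf U1)
    {X : ℕ → Finset ℕ} :
    X ∈ FINinfPair U0 U1 ↔ IsBlockSeq X ∧ blockMins X ∈ U0 ∧ blockMaxs X ∈ U1 := by
  refine and_congr_right fun hX => ⟨fun h => ⟨?_, ?_⟩, ?_⟩
  · by_contra hM
    obtain ⟨Y, hY, hYX, hmin⟩ := h _ (Ultrafilter.compl_mem_iff_notMem.2 hM) _ Filter.univ_mem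
    exact (hmin 0).1 ((hYX 0).least_mem ((Y 0).isLeast_min' _))
  · by_contra hM
    obtain ⟨Y, hY, hYX, hmax⟩ := h _ Filter.univ_mem _ (Ultrafilter.compl_mem_iff_notMem.2 hM)
    exact (hmax 0).2 ((hYX 0).greatest_mem ((Y 0).isGreatest_max' _))
  · rintro ⟨hM, hN⟩ A hA B hB
    have key : ∀ m, ∃ s, InUnions X s ∧ (∀ x ∈ s, m < x) ∧
        (∃ a ∈ A, IsLeast (s : Set ℕ) a) ∧ ∃ b ∈ B, IsGreatest (s : Set ℕ) b := by
      intro m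
      obtain ⟨a, ha, hma⟩ := h0.exists_gt (Filter.inter_mem hA hM) m
      obtain ⟨b, hb, hab⟩ := h1.exists_gt (Filter.inter_mem hB hN) a
      obtain ⟨s, hs, hsa, hsb⟩ := hX.exists_inUnions ha.2 hb.2 hab.le
      exact ⟨s, hs, fun x hx => hma.trans_le (hsa.2 hx), ⟨a, ha.1, hsa⟩, b, hb.1, hsb⟩
    choose F hFX hFm hFA hFB using key
    let Y : ℕ → Finset ℕ := fun n => Nat.rec (F 0) (fun _ s => F (s.sup id)) n
    have hYF : ∀ n, ∃ m, Y n = F m := by rintro (_ | n) <;> exact ⟨_, rfl⟩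
    have hY : IsBlockSeq Y := by
      refine fun i => ⟨?_, fun a ha b hb => ?_⟩
      · obtain ⟨m, hm⟩ := hYF i
        obtain ⟨a, -, ha⟩ := hFA m
        exact hm ▸ ⟨a, ha.1⟩
      · exact (Finset.le_sup (f := id) ha).trans_lt (hFm _ b hb)
    refine ⟨Y, hY, fun n => ?_, fun n => ?_⟩ <;> obtain ⟨m, hm⟩ := hYF n
    · exact hm ▸ hFX m
    · obtain ⟨a, ha, hsa⟩ := hFA m
      obtain ⟨b, hb, hsb⟩ := hFB m
      rw [← hm] at hsa hsb
      exact ⟨((Y n).isLeast_min' _).unique hsa ▸ ha, ((Y n).isGreatest_max' _).unique hsb ▸ hb⟩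

lemma IsRamseyUf.isQPointUf {U : Ultrafilter ℕ} (h : IsRamseyUf U) : IsQPointUf U := by
  classical
  refine ⟨h.1, fun p hp => ?_⟩
  obtain ⟨A, hA, j, hj⟩ := h.2 fun x y => if p x = p y then 0 else 1
  refine ⟨A, hA, ?_⟩
  obtain ⟨x, hx⟩ := (h.1 A hA).nonempty
  obtain ⟨y, ⟨hy, hyx⟩, hpy⟩ : ∃ y ∈ A ∩ Set.Ioi x, y ∉ p ⁻¹' {p x} := by
    by_contra! hc
    exact h.1 _ (Filter.inter_mem hA (h.1.Ioi_mem x)) ((hp (p x)).subset hc)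
  have hj1 : j = 1 := by
    rw [← hj x hx y hy hyx, if_neg fun he => hpy he.symm]
  subst hj1
  intro a ha b hb hab
  rcases lt_trichotomy a b with hlt | rfl | hlt
  · simpa [hab] using hj a ha b hb hlt
  · rfl
  · simpa [hab] using hj b hb a ha hlt

/-- Ramsey ultrafilters are P-points. -/
lemma IsRamseyUf.exists_pseudointersection {U : Ultrafilter ℕ} (h : IsRamseyUf U)
    {M : ℕ → Set ℕ} (hM : ∀ n, M n ∈ U) (hanti : Antitone M) :
    ∃ A ∈ U, ∀ n, ∃ m, ∀ y ∈ A, m < y → y ∈ M n := by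
  classical
  obtain ⟨A, hA, j, hj⟩ := h.2 fun x y => if y ∈ M x then 0 else 1
  refine ⟨A, hA, fun n => ?_⟩
  obtain ⟨x, hx, hnx⟩ := h.1.exists_gt hA n
  obtain ⟨y, ⟨hy, hyM⟩, hxy⟩ := h.1.exists_gt (Filter.inter_mem hA (hM x)) x
  have hj0 : j = 0 := by rw [← hj x hx y hy hxy, if_pos hyM]
  subst hj0
  refine ⟨x, fun z hz hxz => hanti hnx.le ?_⟩
  simpa using hj x hx z hz hxz

lemma UfIso.of_map_eq {U V : Ultrafilter ℕ} (hU : FreeUf U) {p : ℕ → ℕ} {A B : Set ℕ}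
    (hA : A ∈ U) (hB : B ∈ V) (hpA : Set.InjOn p A) (hpB : Set.InjOn p B)
    (hmap : U.map p = V.map p) : UfIso U V := by
  classical
  have hCA : p '' A ∈ U.map p := Filter.image_mem_map hA
  have hCB : p '' B ∈ U.map p := hmap ▸ Filter.image_mem_map hB
  have hC : p '' A ∩ p '' B ∈ U.map p := Filter.inter_mem hCA hCB
  have hfree : ∀ S ∈ U.map p, S ⊆ p '' A → S.Infinite := fun S hS hSA hfin => by
    refine hU _ (Filter.inter_mem hA hS) (Set.Finite.of_finite_image
      (hfin.subset ?_) (hpA.mono Set.inter_subset_left))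
    rintro _ ⟨x, hx, rfl⟩
    exact hx.2
  -- discard an infinite part of the common image, so that both complements become infinite
  obtain ⟨D, D', hDC, hDD, hDU, hD'⟩ : ∃ D D' : Set ℕ, D ∪ D' ⊆ p '' A ∩ p '' B ∧
      Disjoint D D' ∧ D ∈ U.map p ∧ D'.Infinite := by
    obtain ⟨t, u, htu, hd, hcard⟩ :=
      (hfree _ hC Set.inter_subset_left).exists_union_disjoint_cardinal_eq_of_infinite
    have hiff : t.Infinite ↔ u.Infinite := by
      rw [← Set.infinite_coe_iff, ← Set.infinite_coe_iff, Cardinal.infinite_iff, hcard,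
        ← Cardinal.infinite_iff]
    rcases Ultrafilter.union_mem_iff.1 (htu.symm ▸ hC) with h | h
    · exact ⟨t, u, htu.subset, hd, h, hiff.1 (hfree t h fun x hx => (htu.subset (.inl hx)).1)⟩
    · exact ⟨u, t, Set.union_comm t u ▸ htu.subset, hd.symm, h,
        hiff.2 (hfree u h fun x hx => (htu.subset (.inr hx)).1)⟩
  have hequiv : ∀ S : Set ℕ, Set.InjOn p S → D ∪ D' ⊆ p '' S →
      Set.BijOn p (S ∩ p ⁻¹' D) D ∧ (S ∩ p ⁻¹' D)ᶜ.Infinite := by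
    refine fun S hS hDS => ⟨⟨fun x hx => hx.2, hS.mono Set.inter_subset_left, fun y hy => ?_⟩,
      fun hfin => hD' ((hfin.image p).subset fun y hy => ?_)⟩
    · obtain ⟨x, hx, rfl⟩ := hDS (.inl hy)
      exact ⟨x, ⟨hx, hy⟩, rfl⟩
    · obtain ⟨x, hx, rfl⟩ := hDS (.inr hy)
      exact ⟨x, fun hx' => Set.disjoint_left.1 hDD hx'.2 hy, rfl⟩
  obtain ⟨hbA, hiA⟩ := hequiv A hpA (hDC.trans Set.inter_subset_left)
  obtain ⟨hbB, hiB⟩ := hequiv B hpB (hDC.trans Set.inter_subset_right)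
  have := hiA.to_subtype
  have := hiB.to_subtype
  obtain ⟨ec⟩ := nonempty_equiv_of_countable (α := ↥(A ∩ p ⁻¹' D)ᶜ) (β := ↥(B ∩ p ⁻¹' D)ᶜ)
  let e₁ := (hbA.equiv p).trans (hbB.equiv p).symm
  let e : ℕ ≃ ℕ := Equiv.subtypeCongr e₁ ec
  have he : ∀ x ∈ A ∩ p ⁻¹' D, e x ∈ B ∧ p (e x) = p x := by
    intro x hx
    have hex : e x = e₁ ⟨x, hx⟩ := by
      simp [e, Equiv.subtypeCongr, Equiv.sumCompl_symm_apply_of_pos hx]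
    have hp : hbB.equiv p (e₁ ⟨x, hx⟩) = hbA.equiv p ⟨x, hx⟩ := by simp [e₁]
    exact hex ▸ ⟨(e₁ ⟨x, hx⟩).2.1, congrArg Subtype.val hp⟩
  refine ⟨e, Ultrafilter.eq_of_le fun S hS => ?_⟩
  have hSB : p ⁻¹' (p '' (S ∩ B)) ∈ U := by
    rw [← Ultrafilter.mem_map, hmap]
    exact Filter.image_mem_map (Filter.inter_mem hS hB)
  change e ⁻¹' S ∈ U
  filter_upwards [hA, hDU, hSB] with x hxA hxD ⟨y, hy, hyx⟩
  obtain ⟨hB', hpe⟩ := he x ⟨hxA, hxD⟩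
  rw [Set.mem_preimage, ← hpB hy.2 hB' (hyx.trans hpe.symm)]
  exact hy.1

/-- Non-isomorphic Q-points have members on which a finite-to-one map is injective,
with disjoint images. -/
lemma IsQPointUf.exists_separated {U V : Ultrafilter ℕ} (hU : IsQPointUf U)
    (hV : IsQPointUf V) (hne : ¬ UfIso U V) {p : ℕ → ℕ} (hp : ∀ m, (p ⁻¹' {m}).Finite) :
    ∃ A ∈ U, ∃ B ∈ V, Set.InjOn p A ∧ Set.InjOn p B ∧ ∀ x ∈ A, ∀ y ∈ B, p x ≠ p y := by
  obtain ⟨A, hA, hpA⟩ := hU.2 p hp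
  obtain ⟨B, hB, hpB⟩ := hV.2 p hp
  obtain ⟨C, hCV, hCU⟩ : ∃ C ∈ V.map p, C ∉ U.map p := by
    by_contra! hc
    exact hne (.of_map_eq hU.1 hA hB hpA hpB (Ultrafilter.eq_of_le hc))
  refine ⟨A ∩ p ⁻¹' Cᶜ, Filter.inter_mem hA (Ultrafilter.compl_mem_iff_notMem.2 hCU),
    B ∩ p ⁻¹' C, Filter.inter_mem hB hCV, hpA.mono Set.inter_subset_left,
    hpB.mono Set.inter_subset_left, fun x hx y hy hxy => hx.2 ?_⟩
  exact hxy ▸ hy.2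

/-- Members of two non-isomorphic Q-points can be taken so sparse that distinct points of their
union lie at least three intervals apart. -/
lemma IsQPointUf.exists_sparse {U V : Ultrafilter ℕ} (hU : IsQPointUf U)
    (hV : IsQPointUf V) (hne : ¬ UfIso U V) {q : ℕ → ℕ} (hq : ∀ k, {x | q x < k}.Finite) :
    ∃ A ∈ U, ∃ B ∈ V, Disjoint A B ∧
      ∀ x ∈ A ∪ B, ∀ y ∈ A ∪ B, x ≠ y → q x ≤ q y → q x + 3 ≤ q y := by
  have key : ∀ r, ∃ A ∈ U, ∃ B ∈ V, Set.InjOn (fun x => (q x + r) / 3) A ∧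
      Set.InjOn (fun x => (q x + r) / 3) B ∧
      ∀ x ∈ A, ∀ y ∈ B, (q x + r) / 3 ≠ (q y + r) / 3 := fun r =>
    hU.exists_separated hV hne fun m => (hq (3 * m + 3)).subset fun x hx => by
      simp only [Set.mem_preimage, Set.mem_singleton_iff, Set.mem_ofPred_eq] at hx ⊢
      omega
  choose A hA B hB hpA hpB hAB using key
  refine ⟨⋂ r ∈ Set.Iio 3, A r, (Filter.biInter_mem (Set.finite_Iio 3)).2 fun r _ => hA r,
    ⋂ r ∈ Set.Iio 3, B r, (Filter.biInter_mem (Set.finite_Iio 3)).2 fun r _ => hB r, ?_, ?_⟩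
  · refine Set.disjoint_left.2 fun x hxA hxB => ?_
    simp only [Set.mem_iInter] at hxA hxB
    exact hAB 0 x (hxA 0 (by simp)) x (hxB 0 (by simp)) rfl
  · intro x hx y hy hxy hle
    by_contra! hlt
    obtain ⟨r, hr, hrq⟩ : ∃ r < 3, (q x + r) / 3 = (q y + r) / 3 :=
      ⟨(3 - q x % 3) % 3, by omega, by omega⟩
    simp only [Set.mem_union, Set.mem_iInter] at hx hy
    rcases hx with hx | hx <;> rcases hy with hy | hy
    · exact hxy (hpA r (hx r hr) (hy r hr) hrq)
    · exact hAB r x (hx r hr) y (hy r hr) hrq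
    · exact hAB r y (hy r hr) x (hx r hr) hrq.symm
    · exact hxy (hpB r (hx r hr) (hy r hr) hrq)

/-- Consecutive intervals `[g k, g (k + 1))`, the `k`-th meeting both `M k` and `N k`. -/
lemma exists_interval_partition {M N : ℕ → Set ℕ} (hM : ∀ n, (M n).Infinite)
    (hN : ∀ n, (N n).Infinite) :
    ∃ g q : ℕ → ℕ, StrictMono g ∧ (∀ k, ∃ a ∈ M k, g k ≤ a ∧ a < g (k + 1)) ∧
      (∀ k, ∃ b ∈ N k, g k ≤ b ∧ b < g (k + 1)) ∧ ∀ x, g (q x) ≤ x ∧ x < g (q x + 1) := by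
  choose a haM hxa using fun k x => (hM k).exists_gt x
  choose b hbN hxb using fun k x => (hN k).exists_gt x
  obtain ⟨g, hg0, hg⟩ : ∃ g : ℕ → ℕ, g 0 = 0 ∧
      ∀ k, g (k + 1) = max (a k (g k)) (b k (g k)) + 1 :=
    ⟨fun n => Nat.rec 0 (fun k x => max (a k x) (b k x) + 1) n, rfl, fun _ => rfl⟩
  have hmono : StrictMono g := strictMono_nat_of_lt_succ fun k => by
    have := hxa k (g k)
    rw [hg]; omega
  have hq : ∀ x : ℕ, ∃ k : ℕ, g k ≤ x ∧ x < g (k + 1) := by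
    intro x
    have hspec : g (Nat.findGreatest (fun k => g k ≤ x) x) ≤ x :=
      Nat.findGreatest_spec (P := fun k => g k ≤ x) (Nat.zero_le x)
        (hg0.trans_le (Nat.zero_le x))
    refine ⟨_, hspec, ?_⟩
    by_contra! hle
    have := Nat.le_findGreatest (P := fun k => g k ≤ x)
      ((hmono.le_apply (x := Nat.findGreatest (fun k => g k ≤ x) x + 1)).trans hle) hle
    omega
  choose q hq using hq
  refine ⟨g, q, hmono, fun k => ⟨_, haM k (g k), (hxa k _).le, ?_⟩,
    fun k => ⟨_, hbN k (g k), (hxb k _).le, ?_⟩, hq⟩ <;> rw [hg] <;> omega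

/-- Every ≤-descending sequence in `FIN^[∞](⟨U0,U1⟩)` has a ≤*-lower bound
in `FIN^[∞](⟨U0,U1⟩)`. -/
theorem fininfPair_sigma_closed (U0 U1 : Ultrafilter ℕ)
    (h0 : IsRamseyUf U0) (h1 : IsRamseyUf U1) (hne : ¬ UfIso U0 U1)
    (f : ℕ → ℕ → Finset ℕ) (hf : ∀ n, f n ∈ FINinfPair U0 U1)
    (hdesc : ∀ n, Condensation (f (n + 1)) (f n)) :
    ∃ X ∈ FINinfPair U0 U1, ∀ n, CondensationStar X (f n) := by
  classical
  simp only [mem_FINinfPair_iff h0.1 h1.1] at hf ⊢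
  have hMf := blockMins_antitone hdesc
  have hNf := blockMaxs_antitone hdesc
  obtain ⟨A₁, hA₁, hA₁M⟩ := h0.exists_pseudointersection (fun n => (hf n).2.1) hMf
  obtain ⟨B₁, hB₁, hB₁N⟩ := h1.exists_pseudointersection (fun n => (hf n).2.2) hNf
  obtain ⟨g, q, hg, hgM, hgN, hq⟩ := exists_interval_partition
    (fun n => h0.1 _ (hf n).2.1) (fun n => h1.1 _ (hf n).2.2)
  have hqmono : Monotone q := fun x y hxy => by
    have := hg.lt_iff_lt.1 (((hq x).1.trans hxy).trans_lt (hq y).2)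
    omega
  obtain ⟨A₂, hA₂, B₂, hB₂, hdisj, hsparse⟩ := h0.isQPointUf.exists_sparse h1.isQPointUf hne
    (q := q) fun k => (Set.finite_Iio (g k)).subset fun x hx =>
      (hq x).2.trans_le (hg.monotone (Nat.succ_le_of_lt hx))
  have hA : A₁ ∩ A₂ ∩ blockMins (f 0) ∩ Set.Ioi (g 1) ∈ U0 := Filter.inter_mem
    (Filter.inter_mem (Filter.inter_mem hA₁ hA₂) (hf 0).2.1) (h0.1.Ioi_mem _)
  have hB : B₁ ∩ B₂ ∩ blockMaxs (f 0) ∩ Set.Ioi (g 1) ∈ U1 := Filter.inter_mem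
    (Filter.inter_mem (Filter.inter_mem hB₁ hB₂) (hf 0).2.2) (h1.1.Ioi_mem _)
  set A := A₁ ∩ A₂ ∩ blockMins (f 0) ∩ Set.Ioi (g 1)
  set B := B₁ ∩ B₂ ∩ blockMaxs (f 0) ∩ Set.Ioi (g 1)
  have hEsub : A ∪ B ⊆ A₂ ∪ B₂ :=
    Set.union_subset_union (fun x hx => hx.1.1.2) (fun x hx => hx.1.1.2)
  have hq1 : ∀ e ∈ A ∪ B, 1 ≤ q e := by
    intro e he
    have h1e : g 1 < e := he.elim (fun h => h.2) (fun h => h.2)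
    have := hg.lt_iff_lt.1 (h1e.trans (hq e).2)
    omega
  -- the block attached to a point `e` of `A ∪ B`
  have hblock : ∀ e, ∃ s : Finset ℕ, e ∈ A ∪ B → e ∈ s ∧
      (∀ x ∈ s, g (q e - 1) ≤ x ∧ x < g (q e + 2)) ∧
      (e ∈ A → IsLeast (s : Set ℕ) e ∧
        ∀ n < q e, e ∈ blockMins (f n) → InUnions (f n) s) ∧
      (e ∈ B → IsGreatest (s : Set ℕ) e ∧
        ∀ n < q e, e ∈ blockMaxs (f n) → InUnions (f n) s) := by
    intro e
    by_cases heA : e ∈ A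
    · obtain ⟨b, hb, hgb, hbg⟩ := hgN (q e + 1)
      let n := Nat.findGreatest (fun n => e ∈ blockMins (f n)) (q e)
      have hn : e ∈ blockMins (f n) :=
        Nat.findGreatest_spec (P := fun n => e ∈ blockMins (f n)) (Nat.zero_le _) heA.1.2
      have hnq : n ≤ q e + 1 := (Nat.findGreatest_le _).trans (Nat.le_succ _)
      obtain ⟨s, hs, hse, hsb⟩ := (hf n).1.exists_inUnions hn (hNf hnq hb)
        ((hq e).2.le.trans hgb)
      refine ⟨s, fun _ => ⟨hse.1, fun x hx => ⟨?_, (hsb.2 hx).trans_lt hbg⟩,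
        fun _ => ⟨hse, fun m hm hme => InUnions.antitone hdesc s ?_ hs⟩, fun heB =>
        (Set.disjoint_left.1 hdisj heA.1.1.2 heB.1.1.2).elim⟩⟩
      · exact (hg.monotone (Nat.sub_le _ _)).trans ((hq e).1.trans (hse.2 hx))
      · exact Nat.le_findGreatest hm.le hme
    by_cases heB : e ∈ B
    · have hqe := hq1 e (.inr heB)
      obtain ⟨a, ha, hga, hag⟩ := hgM (q e - 1)
      rw [Nat.sub_add_cancel hqe] at hag
      let n := Nat.findGreatest (fun n => e ∈ blockMaxs (f n)) (q e - 1)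
      have hn : e ∈ blockMaxs (f n) :=
        Nat.findGreatest_spec (P := fun n => e ∈ blockMaxs (f n)) (Nat.zero_le _) heB.1.2
      obtain ⟨s, hs, hsa, hse⟩ := (hf n).1.exists_inUnions
        (hMf (Nat.findGreatest_le _) ha) hn (hag.le.trans (hq e).1)
      refine ⟨s, fun _ => ⟨hse.1, fun x hx => ⟨hga.trans (hsa.2 hx), ?_⟩,
        fun heA' => (heA heA').elim,
        fun _ => ⟨hse, fun m hm hme => InUnions.antitone hdesc s ?_ hs⟩⟩⟩
      · exact (hse.2 hx).trans_lt ((hq e).2.trans (hg (Nat.lt_succ_self _)))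
      · exact Nat.le_findGreatest (Nat.le_sub_one_of_lt hm) hme
    · exact ⟨∅, fun h => (h.elim heA heB).elim⟩
  choose s hs using hblock
  have hE : (A ∪ B).Infinite := (h0.1 A hA).mono Set.subset_union_left
  let e := Nat.nth (· ∈ A ∪ B)
  have he : ∀ i, e i ∈ A ∪ B := Nat.nth_mem_of_infinite hE
  have hemono : StrictMono e := Nat.nth_strictMono hE
  have hesurj : ∀ x ∈ A ∪ B, ∃ i, e i = x := fun x hx => ⟨_, Nat.nth_count hx⟩
  refine ⟨fun i => s (e i), ⟨fun i => ⟨⟨_, (hs _ (he i)).1⟩, fun a ha b hb => ?_⟩,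
    Filter.mem_of_superset hA fun x hx => ?_, Filter.mem_of_superset hB fun x hx => ?_⟩,
    fun n => ?_⟩
  · have hlt := hemono (Nat.lt_succ_self i)
    have := hsparse _ (hEsub (he i)) _ (hEsub (he (i + 1))) hlt.ne (hqmono hlt.le)
    exact (((hs _ (he i)).2.1 a ha).2.trans_le (hg.monotone (by omega))).trans_le
      ((hs _ (he (i + 1))).2.1 b hb).1
  · obtain ⟨i, rfl⟩ := hesurj x (.inl hx)
    exact ⟨i, ((hs _ (he i)).2.2.1 hx).1⟩
  · obtain ⟨i, rfl⟩ := hesurj x (.inr hx)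
    exact ⟨i, ((hs _ (he i)).2.2.2 hx).1⟩
  · obtain ⟨mA, hmA⟩ := hA₁M n
    obtain ⟨mB, hmB⟩ := hB₁N n
    let m := max (max mA mB) (g (n + 1))
    refine ⟨g (q m + 2), fun i hi => ?_⟩
    have hei := hs _ (he i)
    have hqlt : q m < q (e i) := by
      have := hg.lt_iff_lt.1 ((hi _ hei.1).trans (hei.2.1 _ hei.1).2)
      omega
    have hmlt : m < e i := hqmono.reflect_lt hqlt
    have hnq : n < q (e i) := by
      have : g (n + 1) ≤ m := le_max_right _ _
      have := hg.lt_iff_lt.1 (this.trans_lt (hmlt.trans (hq (e i)).2))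
      omega
    rcases he i with h | h
    · exact (hei.2.2.1 h).2 n hnq (hmA _ h.1.1.1 (by omega))
    · exact (hei.2.2.2 h).2 n hnq (hmB _ h.1.1.1 (by omega))
end
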